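/- arXiv:math/0703302 — 6 statements merged into one kernel-verified Lean document; each statement's English description precedes it below -/
import Mathlib

section
/- Let T ⊆ 2^{<ω} be a perfect tree with canonical term sequence t̄ = (t_n)_{n∈ℕ}. For each n ∈ ℕ, the set F_n of n-th splitting nodes of T is finite and nonempty; let l be the maximum of the lengths of the nodes in F_n. Then the variable x_n is determined by the terms t_0, …, t_l: for all assignments a, b, if t_i(a) = t_i(b) for all i ≤ l, then a(n) = b(n). -/
open Classical

/-- `t` is a splitting node of `T`: both immediate successors of `t` belong to `T`. -/
def SplitNode (T : Set (List Bool)) (t : List Bool) : Prop :=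
  t ∈ T ∧ t.concat false ∈ T ∧ t.concat true ∈ T

/-- A perfect tree: a nonempty set of finite binary sequences, closed under initial
segments, in which every node has a splitting node extending it. -/
def PerfectTree (T : Set (List Bool)) : Prop :=
  T.Nonempty ∧ (∀ s t : List Bool, s <+: t → t ∈ T → s ∈ T) ∧
    (∀ t ∈ T, ∃ s, t <+: s ∧ SplitNode T s)

/-- `F_n`: the set of `n`-th splitting nodes of `T`. -/
def NthSplitSet (T : Set (List Bool)) (n : ℕ) : Set (List Bool) :=
  {t | SplitNode T t ∧ {s | SplitNode T s ∧ s <+: t ∧ s ≠ t}.ncard = n}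

/-- The number of splitting nodes of `T` that are proper initial segments of `t`. -/
noncomputable def splitIdx (T : Set (List Bool)) (t : List Bool) : ℕ :=
  {s | SplitNode T s ∧ s <+: t ∧ s ≠ t}.ncard

/-- The initial segment of length `n` of the branch `b_a` of `T` determined by the
assignment `a`. -/
noncomputable def branchNode (T : Set (List Bool)) (a : ℕ → Bool) : ℕ → List Bool
  | 0 => []
  | n + 1 =>
      (branchNode T a n).concat
        (if SplitNode T (branchNode T a n) then a (splitIdx T (branchNode T a n))
         else if (branchNode T a n).concat true ∈ T then true else false)

/-- The canonical term sequence of `T`:  `canonTerm T n a = b_a(n)`. -/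
noncomputable def canonTerm (T : Set (List Bool)) (n : ℕ) (a : ℕ → Bool) : Bool :=
  (branchNode T a (n + 1)).getLastD false

theorem splitIdx_nil (T : Set (List Bool)) : splitIdx T [] = 0 := by
  simp [splitIdx]

theorem finite_splitNode_properPrefix (T : Set (List Bool)) (t : List Bool) :
    {s | SplitNode T s ∧ s <+: t ∧ s ≠ t}.Finite :=
  (t.inits.toFinset.finite_toSet).subset fun s hs => by
    simpa using hs.2.1

theorem splitIdx_concat (T : Set (List Bool)) (t : List Bool) (c : Bool) :
    splitIdx T (t.concat c) = splitIdx T t + if SplitNode T t then 1 else 0 := by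
  have hmem : ∀ s, (s <+: t.concat c ∧ s ≠ t.concat c) ↔ s <+: t := by
    intro s
    rw [List.concat_eq_append, List.prefix_concat_iff]
    constructor
    · rintro ⟨h | h, h'⟩
      · exact absurd h h'
      · exact h
    · intro h
      refine ⟨Or.inr h, ?_⟩
      rintro rfl
      simpa using h.length_le
  unfold splitIdx
  simp only [hmem]
  split_ifs with hs
  · have h : {s | SplitNode T s ∧ s <+: t} =
        insert t {s | SplitNode T s ∧ s <+: t ∧ s ≠ t} := by
      ext s
      by_cases hst : s = t
      · subst hst; simp [hs]
      · simp [hst]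
    rw [h, Set.ncard_insert_of_notMem (by simp) (finite_splitNode_properPrefix T t)]
  · congr 1
    ext s
    by_cases hst : s = t
    · subst hst; simp [hs]
    · simp [hst]

theorem length_branchNode (T : Set (List Bool)) (a : ℕ → Bool) (m : ℕ) :
    (branchNode T a m).length = m := by
  induction m with
  | zero => rfl
  | succ m ih => simp [branchNode, ih]

theorem branchNode_succ (T : Set (List Bool)) (a : ℕ → Bool) (m : ℕ) :
    branchNode T a (m + 1) = (branchNode T a m).concat (canonTerm T m a) := by
  simp [canonTerm, branchNode]

theorem canonTerm_of_splitNode {T : Set (List Bool)} {a : ℕ → Bool} {m : ℕ}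
    (h : SplitNode T (branchNode T a m)) :
    canonTerm T m a = a (splitIdx T (branchNode T a m)) := by
  simp [canonTerm, branchNode, h]

theorem canonTerm_of_not_splitNode {T : Set (List Bool)} (hT : PerfectTree T)
    {a : ℕ → Bool} {m : ℕ} (h : ¬ SplitNode T (branchNode T a m)) {c : Bool}
    (hc : (branchNode T a m).concat c ∈ T) : canonTerm T m a = c := by
  have hmem : branchNode T a m ∈ T := hT.2.1 _ _ (by simp) hc
  cases c
  · have h' : (branchNode T a m).concat true ∉ T := fun h' => h ⟨hmem, hc, h'⟩
    simp only [canonTerm, branchNode, if_neg h, if_neg h']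
    simp
  · simp only [canonTerm, branchNode, if_neg h, if_pos hc]
    simp

theorem splitIdx_branchNode_mono (T : Set (List Bool)) (a : ℕ → Bool) :
    Monotone fun m => splitIdx T (branchNode T a m) :=
  monotone_nat_of_le_succ fun m => by
    simp only [branchNode_succ, splitIdx_concat]
    omega

theorem splitIdx_branchNode_lt {T : Set (List Bool)} {a : ℕ → Bool} {m k : ℕ}
    (h : SplitNode T (branchNode T a m)) (hmk : m < k) :
    splitIdx T (branchNode T a m) < splitIdx T (branchNode T a k) := by
  have h' := splitIdx_branchNode_mono T a (Nat.succ_le_of_lt hmk)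
  simp only [Nat.succ_eq_add_one, branchNode_succ, splitIdx_concat, if_pos h] at h'
  omega

theorem branchNode_congr {T : Set (List Bool)} {a b : ℕ → Bool} {m : ℕ}
    (h : ∀ k < splitIdx T (branchNode T a m), a k = b k) :
    branchNode T a m = branchNode T b m := by
  induction m with
  | zero => rfl
  | succ m ih =>
    have e := ih fun k hk => h k (hk.trans_le (splitIdx_branchNode_mono T a m.le_succ))
    simp only [branchNode, ← e]
    split_ifs with hs
    · rw [h _ (splitIdx_branchNode_lt hs m.lt_succ_self)]
    · rfl
    · rfl

theorem exists_branchNode_eq {T : Set (List Bool)} (hT : PerfectTree T) (t : List Bool)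
    (ht : t ∈ T) : ∃ a, branchNode T a t.length = t := by
  induction t using List.reverseRecOn with
  | nil => exact ⟨fun _ => false, rfl⟩
  | append_singleton t c ih =>
    obtain ⟨a, ha⟩ := ih (hT.2.1 _ _ (List.prefix_append _ _) ht)
    let b := Function.update a (splitIdx T t) c
    have hb : branchNode T b t.length = t := by
      rw [← branchNode_congr (a := a), ha]
      intro k hk
      rw [ha] at hk
      simp [b, Function.update_of_ne hk.ne]
    refine ⟨b, ?_⟩
    have hc : canonTerm T t.length b = c := by
      by_cases hs : SplitNode T t
      · rw [canonTerm_of_splitNode (by rwa [hb]), hb]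
        simp [b]
      · exact canonTerm_of_not_splitNode hT (by rwa [hb]) (by simpa [hb] using ht)
    simp [branchNode_succ, hb, hc]

theorem exists_splitNode_branchNode_of_prefix {T : Set (List Bool)} (hT : PerfectTree T)
    (a : ℕ → Bool) (s : List Bool) (hs : SplitNode T s) (k m : ℕ) (hk : s.length = m + k)
    (hp : branchNode T a m <+: s) :
    ∃ m', SplitNode T (branchNode T a m') ∧
      splitIdx T (branchNode T a m') = splitIdx T (branchNode T a m) := by
  induction k generalizing m with
  | zero =>
    have e := hp.eq_of_length (by simp [length_branchNode, hk])
    exact ⟨m, e ▸ hs, rfl⟩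
  | succ k ih =>
    by_cases hsplit : SplitNode T (branchNode T a m)
    · exact ⟨m, hsplit, rfl⟩
    obtain ⟨r, rfl⟩ := hp
    cases r with
    | nil => simp [length_branchNode] at hk
    | cons c r =>
      have hpc : (branchNode T a m).concat c <+: branchNode T a m ++ c :: r := by
        simp
      have hc := canonTerm_of_not_splitNode hT hsplit (hT.2.1 _ _ hpc hs.1)
      obtain ⟨m', h₁, h₂⟩ := ih (m + 1) (by omega) (by rwa [branchNode_succ, hc])
      refine ⟨m', h₁, ?_⟩
      rw [h₂, branchNode_succ, splitIdx_concat, if_neg hsplit, Nat.add_zero]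

theorem branchNode_mem {T : Set (List Bool)} (hT : PerfectTree T) (a : ℕ → Bool) (m : ℕ) :
    branchNode T a m ∈ T := by
  induction m with
  | zero =>
    obtain ⟨t, ht⟩ := hT.1
    exact hT.2.1 _ _ List.nil_prefix ht
  | succ m ih =>
    rw [branchNode_succ]
    by_cases hsplit : SplitNode T (branchNode T a m)
    · cases canonTerm T m a
      · exact hsplit.2.1
      · exact hsplit.2.2
    · obtain ⟨s, ⟨r, rfl⟩, hs⟩ := hT.2.2 _ ih
      cases r with
      | nil => simp [hsplit] at hs
      | cons c r =>
        have hc : (branchNode T a m).concat c ∈ T := hT.2.1 _ _ (by simp) hs.1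
        rwa [canonTerm_of_not_splitNode hT hsplit hc]

theorem exists_branchNode_mem_nthSplitSet {T : Set (List Bool)} (hT : PerfectTree T)
    (a : ℕ → Bool) (n : ℕ) : ∃ m, branchNode T a m ∈ NthSplitSet T n := by
  have next : ∀ m, ∃ m', SplitNode T (branchNode T a m') ∧
      splitIdx T (branchNode T a m') = splitIdx T (branchNode T a m) := by
    intro m
    obtain ⟨s, hp, hs⟩ := hT.2.2 _ (branchNode_mem hT a m)
    have hle := hp.length_le
    rw [length_branchNode] at hle
    exact exists_splitNode_branchNode_of_prefix hT a s hs (s.length - m) m (by omega) hp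
  induction n with
  | zero =>
    obtain ⟨m, h₁, h₂⟩ := next 0
    exact ⟨m, h₁, h₂.trans (splitIdx_nil T)⟩
  | succ n ih =>
    obtain ⟨m, h₁, h₂⟩ := ih
    obtain ⟨m', h₃, h₄⟩ := next (m + 1)
    refine ⟨m', h₃, h₄.trans ?_⟩
    rw [branchNode_succ, splitIdx_concat, if_pos h₁]
    exact congrArg (· + 1) h₂

theorem branchNode_mem_nthSplitSet_unique {T : Set (List Bool)} {a : ℕ → Bool} {n m k : ℕ}
    (hm : branchNode T a m ∈ NthSplitSet T n) (hk : branchNode T a k ∈ NthSplitSet T n) :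
    m = k := by
  have e : splitIdx T (branchNode T a m) = splitIdx T (branchNode T a k) :=
    hm.2.trans hk.2.symm
  rcases lt_trichotomy m k with h | h | h
  · exact absurd e (splitIdx_branchNode_lt hm.1 h).ne
  · exact h
  · exact absurd e (splitIdx_branchNode_lt hk.1 h).ne'

theorem finite_nthSplitSet {T : Set (List Bool)} (hT : PerfectTree T) (n : ℕ) :
    (NthSplitSet T n).Finite := by
  choose m hm using fun a => exists_branchNode_mem_nthSplitSet hT a n
  let pad : (Fin n → Bool) → ℕ → Bool := fun f k => if h : k < n then f ⟨k, h⟩ else false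
  refine (Set.finite_range fun f => branchNode T (pad f) (m (pad f))).subset ?_
  intro t ht
  obtain ⟨a, ha⟩ := exists_branchNode_eq hT t ht.1.1
  have e : branchNode T (pad fun i => a i) t.length = t := by
    rw [← branchNode_congr (a := a), ha]
    intro k hk
    have hn : splitIdx T t = n := ht.2
    rw [ha, hn] at hk
    simp [pad, hk]
  refine ⟨fun i => a i, ?_⟩
  have hlen := branchNode_mem_nthSplitSet_unique (hm (pad fun i => a i)) (e.symm ▸ ht)
  simp only [hlen, e]

theorem branchNode_eq_of_canonTerm_eq {T : Set (List Bool)} {a b : ℕ → Bool} {m : ℕ}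
    (h : ∀ i < m, canonTerm T i a = canonTerm T i b) :
    branchNode T a m = branchNode T b m := by
  induction m with
  | zero => rfl
  | succ m ih =>
    rw [branchNode_succ, branchNode_succ, ih fun i hi => h i (hi.trans m.lt_succ_self),
      h m m.lt_succ_self]

/-- For a perfect tree `T`, the set `F_n` of `n`-th splitting nodes is finite and
nonempty, and if `l` is the maximum of the lengths of nodes in `F_n`, then the
variable `x_n` is determined by the canonical terms `t_0, …, t_l`. -/
theorem nthSplit_finite_nonempty_determines (T : Set (List Bool)) (hT : PerfectTree T)
    (n : ℕ) :
    (NthSplitSet T n).Finite ∧ (NthSplitSet T n).Nonempty ∧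
      ∀ l : ℕ, IsGreatest (List.length '' NthSplitSet T n) l →
        ∀ a b : ℕ → Bool, (∀ i ≤ l, canonTerm T i a = canonTerm T i b) → a n = b n := by
  refine ⟨finite_nthSplitSet hT n, ?_, ?_⟩
  · obtain ⟨m, hm⟩ := exists_branchNode_mem_nthSplitSet hT (fun _ => false) n
    exact ⟨_, hm⟩
  · intro l hl a b hab
    obtain ⟨m, hm⟩ := exists_branchNode_mem_nthSplitSet hT a n
    have hml : m ≤ l := by
      simpa [length_branchNode] using hl.2 (Set.mem_image_of_mem _ hm)
    have e : branchNode T a m = branchNode T b m :=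
      branchNode_eq_of_canonTerm_eq fun i hi => hab i (hi.le.trans hml)
    have hn : splitIdx T (branchNode T a m) = n := hm.2
    have h := hab m hml
    rwa [canonTerm_of_splitNode hm.1, canonTerm_of_splitNode (e ▸ hm.1), ← e, hn] at h
end

section
/- If s̄, t̄ ∈ S*, then s̄∘t̄ (the result of applying t̄ to s̄ as the substitution sending x_i to t_i) is again an element of S*, and s̄∘t̄ ≤ s̄ in S*. -/
/-- `t` depends only on the variables `x_j` with `j ∈ Y`. -/
def DependsOnly (t : (ℕ → Bool) → Bool) (Y : Set ℕ) : Prop :=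
  ∀ a b : ℕ → Bool, (∀ j ∈ Y, a j = b j) → t a = t b

/-- A term: a function of the assignments depending only on finitely many variables. -/
def IsTerm (t : (ℕ → Bool) → Bool) : Prop :=
  ∃ Y : Finset ℕ, DependsOnly t ↑Y

/-- The variable `x_j` is determined by the finite family of terms `(t k)_{k ∈ K}`. -/
def Determines (t : ℕ → (ℕ → Bool) → Bool) (K : Finset ℕ) (j : ℕ) : Prop :=
  ∀ a b : ℕ → Bool, (∀ k ∈ K, t k a = t k b) → a j = b j

/-- `S*`: sequences of terms `t̄` such that `t i` depends only on variables `x_j`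
with `j ≤ i` and each variable `x_j` is determined by finitely many of the `t i`. -/
def InSStar (t : ℕ → (ℕ → Bool) → Bool) : Prop :=
  (∀ i, DependsOnly (t i) {j | j ≤ i}) ∧ (∀ j, ∃ K : Finset ℕ, Determines t K j)

/-- Application of the substitution `φ` to the term `t`: `(t∘φ)(a) = t(i ↦ φ_i(a))`. -/
def substTerm (t : (ℕ → Bool) → Bool) (φ : ℕ → (ℕ → Bool) → Bool) :
    (ℕ → Bool) → Bool :=
  fun a => t fun i => φ i a

/-- The order on `S*`:  `t' ≤ t` iff `t' = t∘φ` for a substitution `φ` such that each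
`φ_i` depends only on variables `x_j` with `j ≤ i` and each variable `x_j` is
determined by finitely many of the `φ_i`. -/
def SLE (t' t : ℕ → (ℕ → Bool) → Bool) : Prop :=
  ∃ φ : ℕ → (ℕ → Bool) → Bool,
    (∀ i, t' i = substTerm (t i) φ) ∧
    (∀ i, DependsOnly (φ i) {j | j ≤ i}) ∧
    (∀ j, ∃ K : Finset ℕ, Determines φ K j)

/-- Triangular substitutions preserve dependence on an initial segment of the variables. -/
theorem DependsOnly.substTerm {s : (ℕ → Bool) → Bool} {t : ℕ → (ℕ → Bool) → Bool} {i : ℕ}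
    (hs : DependsOnly s {j | j ≤ i}) (ht : ∀ k, DependsOnly (t k) {j | j ≤ k}) :
    DependsOnly (substTerm s t) {j | j ≤ i} :=
  fun a b hab => hs _ _ fun k hk => ht k a b fun j hj => hab j (Set.mem_ofPred.2 (le_trans hj hk))

/-- If `x_j` is determined by `(t k)_{k ∈ K}` and each `x_k` with `k ∈ K` is determined by
`(s l)_{l ∈ L k}`, then `x_j` is determined by the terms `s l ∘ t` with `l ∈ ⋃ k ∈ K, L k`. -/
theorem Determines.substTerm {s t : ℕ → (ℕ → Bool) → Bool} {K : Finset ℕ} {j : ℕ}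
    {L : ℕ → Finset ℕ} (ht : Determines t K j) (hs : ∀ k ∈ K, Determines s (L k) k) :
    Determines (fun i => substTerm (s i) t) (K.biUnion L) j :=
  fun a b hab => ht a b fun k hk => hs k hk (fun i => t i a) (fun i => t i b) fun l hl =>
    hab l (Finset.mem_biUnion.2 ⟨k, hk, hl⟩)

/-- If `s̄, t̄ ∈ S*`, then `s̄∘t̄` (applying `t̄` to `s̄` as a substitution) is again in
`S*` and is stronger than `s̄`. -/
theorem comp_mem_SStar_and_le (s t : ℕ → (ℕ → Bool) → Bool)
    (hs : InSStar s) (ht : InSStar t) :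
    InSStar (fun i => substTerm (s i) t) ∧ SLE (fun i => substTerm (s i) t) s := by
  refine ⟨⟨fun i => (hs.1 i).substTerm ht.1, fun j => ?_⟩, t, fun _ => rfl, ht⟩
  obtain ⟨K, hK⟩ := ht.2 j
  choose L hL using hs.2
  exact ⟨K.biUnion L, hK.substTerm fun k _ => hL k⟩
end

section
/- Let t̄ ∈ S* and let φ be any substitution such that t̄∘φ ∈ S*. Then each variable x_j is determined by some finite subfamily of the terms φ_i. (Thus clause (ii) in the definition of the order on S* is automatic.) -/
/-- If `t̄ ∈ S*` and `φ` is any substitution with `t̄∘φ ∈ S*`, then each variable `x_j`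
is determined by finitely many of the `φ_i`; so clause (ii) of the order on `S*` is
automatic. -/
theorem substitution_determines_of_comp_mem (t φ : ℕ → (ℕ → Bool) → Bool)
    (ht : InSStar t) (hφ : ∀ i, IsTerm (φ i))
    (htφ : InSStar (fun i => substTerm (t i) φ)) :
    ∀ j, ∃ K : Finset ℕ, Determines φ K j := by
  intro j
  obtain ⟨K, hK⟩ := htφ.2 j
  refine ⟨Finset.range (K.sup id + 1), fun a b hab => hK a b fun k hk => ?_⟩
  refine ht.1 k _ _ fun i hi => hab i ?_
  exact Finset.mem_range_succ_iff.2 (le_trans hi (Finset.le_sup (f := id) hk))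
end

section
/- For every t̄ ∈ S*, the set Ψ(t̄) is a perfect tree. -/
/-- `Ψ(t̄) = { (t_0(a), …, t_{n−1}(a)) : n ∈ ℕ, a an assignment }`. -/
def Psi (t : ℕ → (ℕ → Bool) → Bool) : Set (List Bool) :=
  {l | ∃ (n : ℕ) (a : ℕ → Bool), l = List.ofFn fun i : Fin n => t i a}

theorem ofFn_mem_Psi (t : ℕ → (ℕ → Bool) → Bool) (n : ℕ) (a : ℕ → Bool) :
    (List.ofFn fun i : Fin n => t i a) ∈ Psi t :=
  ⟨n, a, rfl⟩

theorem ofFn_prefix_ofFn {α : Type*} (f : ℕ → α) {n k : ℕ} (h : n ≤ k) :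
    (List.ofFn fun i : Fin n => f i) <+: List.ofFn fun i : Fin k => f i := by
  rw [List.prefix_iff_eq_take]
  apply List.ext_getElem
  · simp [h]
  · intro i h₁ h₂
    simp

theorem ofFn_concat {α : Type*} (f : ℕ → α) (k : ℕ) :
    (List.ofFn fun i : Fin k => f i).concat (f k) = List.ofFn fun i : Fin (k + 1) => f i :=
  (List.ofFn_succ' fun i : Fin (k + 1) => f i).symm

/-- If `a` and `b` differ at a determined variable, there is a first term separating them. -/
theorem exists_first_separating {t : ℕ → (ℕ → Bool) → Bool} {K : Finset ℕ} {j : ℕ}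
    (hK : Determines t K j) {a b : ℕ → Bool} (hab : a j ≠ b j) :
    ∃ k, t k a ≠ t k b ∧ ∀ i < k, t i a = t i b := by
  classical
  have h : ∃ k, t k a ≠ t k b := by
    by_contra! h
    exact hab (hK a b fun k _ => h k)
  exact ⟨Nat.find h, Nat.find_spec h, fun i hi => not_not.mp (Nat.find_min h hi)⟩

theorem splitNode_ofFn {t : ℕ → (ℕ → Bool) → Bool} {k : ℕ} {a b : ℕ → Bool}
    (hk : t k a ≠ t k b) (hlt : ∀ i < k, t i a = t i b) :
    SplitNode (Psi t) (List.ofFn fun i : Fin k => t i a) := by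
  have ha : (List.ofFn fun i : Fin k => t i a).concat (t k a) ∈ Psi t := by
    rw [ofFn_concat fun i => t i a]
    exact ofFn_mem_Psi t (k + 1) a
  have hb : (List.ofFn fun i : Fin k => t i a).concat (t k b) ∈ Psi t := by
    have h : (fun i : Fin k => t i a) = fun i : Fin k => t i b :=
      funext fun i => hlt i i.isLt
    rw [h, ofFn_concat fun i => t i b]
    exact ofFn_mem_Psi t (k + 1) b
  refine ⟨ofFn_mem_Psi t k a, ?_⟩
  cases hta : t k a <;> cases htb : t k b <;> simp_all

/-- For every `t̄ ∈ S*`, the set `Ψ(t̄)` is a perfect tree. -/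
theorem Psi_perfectTree (t : ℕ → (ℕ → Bool) → Bool) (ht : InSStar t) :
    PerfectTree (Psi t) := by
  obtain ⟨hdep, hdet⟩ := ht
  refine ⟨⟨_, ofFn_mem_Psi t 0 fun _ => false⟩, ?_, ?_⟩
  · rintro s _ hs ⟨n, a, rfl⟩
    have hlen : s.length ≤ n := by simpa using hs.length_le
    have hs' : s = List.ofFn fun i : Fin s.length => t i a :=
      (List.prefix_of_prefix_length_le hs (ofFn_prefix_ofFn (fun i => t i a) hlen)
        (by simp)).eq_of_length (by simp)
    exact ⟨s.length, a, hs'⟩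
  · rintro _ ⟨n, a, rfl⟩
    obtain ⟨K, hK⟩ := hdet n
    let b := Function.update a n (!a n)
    have hab : a n ≠ b n := by simp [b]
    obtain ⟨k, hk, hlt⟩ := exists_first_separating hK hab
    have hnk : n ≤ k := by
      by_contra! hkn
      refine hk (hdep k a b fun j (hj : j ≤ k) => ?_)
      have hjn : j ≠ n := by omega
      simp [b, hjn]
    exact ⟨_, ofFn_prefix_ofFn (fun i => t i a) hnk, splitNode_ofFn hk hlt⟩
end

section
/- For every perfect tree T ⊆ 2^{<ω} there exists t̄ ∈ S* with Ψ(t̄) = T; i.e., Ψ maps S* onto the set of all perfect trees (Sacks conditions). -/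
open Classical in
/-- One step along the branch of `T` coded by `a`: at a splitting node with `k` splitting nodes
below it the next bit is `a k`; at any other node of `T` it is the only possible one. -/
noncomputable def nextBit (T : Set (List Bool)) (a : ℕ → Bool) (p : List Bool × ℕ) : Bool :=
  if SplitNode T p.1 then a p.2 else decide (p.1 ++ [true] ∈ T)

open Classical in
/-- The node at level `n` of the branch of `T` coded by `a`, together with the number of
splitting nodes strictly below it. -/
noncomputable def branch (T : Set (List Bool)) (a : ℕ → Bool) : ℕ → List Bool × ℕ
  | 0 => ([], 0)
  | n + 1 => ((branch T a n).1 ++ [nextBit T a (branch T a n)],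
      if SplitNode T (branch T a n).1 then (branch T a n).2 + 1 else (branch T a n).2)

section branch

variable {T : Set (List Bool)} {a b : ℕ → Bool} {n : ℕ}

lemma branch_succ_fst : (branch T a (n + 1)).1 =
    (branch T a n).1 ++ [nextBit T a (branch T a n)] := rfl

lemma branch_succ_snd_of_split (h : SplitNode T (branch T a n).1) :
    (branch T a (n + 1)).2 = (branch T a n).2 + 1 := by
  simp [branch, h]

lemma branch_succ_snd_of_not_split (h : ¬ SplitNode T (branch T a n).1) :
    (branch T a (n + 1)).2 = (branch T a n).2 := by
  simp [branch, h]

lemma branch_succ_eq (h : branch T a n = branch T b n)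
    (hbit : nextBit T a (branch T a n) = nextBit T b (branch T b n)) :
    branch T a (n + 1) = branch T b (n + 1) := by
  simp only [branch, hbit]
  rw [h]

lemma monotone_branch_snd (T : Set (List Bool)) (a : ℕ → Bool) :
    Monotone fun n => (branch T a n).2 := by
  refine monotone_nat_of_le_succ fun n => ?_
  by_cases h : SplitNode T (branch T a n).1
  · simp [branch_succ_snd_of_split h]
  · simp [branch_succ_snd_of_not_split h]

lemma branch_snd_le (T : Set (List Bool)) (a : ℕ → Bool) (n : ℕ) : (branch T a n).2 ≤ n := by
  induction n with
  | zero => simp [branch]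
  | succ n ih =>
    by_cases h : SplitNode T (branch T a n).1
    · rw [branch_succ_snd_of_split h]; omega
    · rw [branch_succ_snd_of_not_split h]; omega

lemma branch_fst_eq_ofFn (T : Set (List Bool)) (a : ℕ → Bool) (n : ℕ) :
    (branch T a n).1 = List.ofFn fun i : Fin n => nextBit T a (branch T a i) := by
  induction n with
  | zero => simp [branch]
  | succ n ih =>
    rw [List.ofFn_succ', List.concat_eq_append, branch_succ_fst]
    simp [ih]

/-- A branch up to level `n` depends only on the variables it has used. -/
lemma branch_eq_of_agree (h : ∀ i < (branch T a n).2, a i = b i) :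
    branch T a n = branch T b n := by
  induction n with
  | zero => rfl
  | succ n ih =>
    have e := ih fun i hi => h i (hi.trans_le (monotone_branch_snd T a n.le_succ))
    refine branch_succ_eq e ?_
    rw [← e]
    by_cases hs : SplitNode T (branch T a n).1
    · simp only [nextBit, hs, if_true]
      exact h _ (by rw [branch_succ_snd_of_split hs]; omega)
    · simp only [nextBit, hs, if_false]

/-- The bits along a branch determine the variables it has used. -/
lemma agree_of_nextBit_eq
    (h : ∀ k < n, nextBit T a (branch T a k) = nextBit T b (branch T b k)) :
    branch T a n = branch T b n ∧ ∀ i < (branch T a n).2, a i = b i := by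
  induction n with
  | zero => simp [branch]
  | succ n ih =>
    obtain ⟨e, hi⟩ := ih fun k hk => h k (by omega)
    have hb := h n n.lt_succ_self
    refine ⟨branch_succ_eq e hb, ?_⟩
    by_cases hs : SplitNode T (branch T a n).1
    · rw [branch_succ_snd_of_split hs]
      intro i hlt
      rcases Nat.lt_succ_iff_lt_or_eq.1 hlt with hlt | rfl
      · exact hi i hlt
      · rw [← e] at hb
        simpa only [nextBit, hs, if_true] using hb
    · rwa [branch_succ_snd_of_not_split hs]

end branch

lemma PerfectTree.exists_append_mem {T : Set (List Bool)} (hT : PerfectTree T) {s : List Bool}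
    (hs : s ∈ T) : ∃ b, s ++ [b] ∈ T := by
  obtain ⟨u, ⟨r, rfl⟩, -, -, hu⟩ := hT.2.2 s hs
  cases r with
  | nil => exact ⟨true, by simpa using hu⟩
  | cons b r => exact ⟨b, hT.2.1 _ _ ⟨r ++ [true], by simp⟩ hu⟩

lemma PerfectTree.append_nextBit_mem {T : Set (List Bool)} (hT : PerfectTree T) (a : ℕ → Bool)
    {p : List Bool × ℕ} (hp : p.1 ∈ T) : p.1 ++ [nextBit T a p] ∈ T := by
  by_cases hs : SplitNode T p.1
  · simp only [nextBit, hs, if_true]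
    cases a p.2
    · simpa using hs.2.1
    · simpa using hs.2.2
  · simp only [nextBit, hs, if_false]
    by_cases ht : p.1 ++ [true] ∈ T
    · simp [ht]
    · obtain ⟨b, hb⟩ := hT.exists_append_mem hp
      cases b
      · simpa [ht] using hb
      · exact absurd hb ht

lemma eq_nextBit_of_not_split {T : Set (List Bool)} (a : ℕ → Bool) {p : List Bool × ℕ}
    (hp : p.1 ∈ T) (hs : ¬ SplitNode T p.1) {c : Bool} (hc : p.1 ++ [c] ∈ T) :
    c = nextBit T a p := by
  simp only [nextBit, hs, if_false]
  cases c
  · have : p.1 ++ [true] ∉ T := fun ht => hs ⟨hp, by simpa using hc, by simpa using ht⟩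
    simp [this]
  · simp [hc]

lemma PerfectTree.branch_mem {T : Set (List Bool)} (hT : PerfectTree T) (a : ℕ → Bool) (n : ℕ) :
    (branch T a n).1 ∈ T := by
  induction n with
  | zero =>
    obtain ⟨s, hs⟩ := hT.1
    exact hT.2.1 _ _ s.nil_prefix hs
  | succ n ih => exact hT.append_nextBit_mem a ih

lemma PerfectTree.exists_branch_eq {T : Set (List Bool)} (hT : PerfectTree T) (s : List Bool)
    (hs : s ∈ T) : ∃ a, (branch T a s.length).1 = s := by
  induction s using List.reverseRecOn with
  | nil => exact ⟨fun _ => false, rfl⟩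
  | append_singleton s c ih =>
    have hsT : s ∈ T := hT.2.1 _ _ ⟨[c], rfl⟩ hs
    obtain ⟨a, ha⟩ := ih hsT
    rw [List.length_append, List.length_singleton]
    by_cases hsp : SplitNode T s
    · set k := (branch T a s.length).2 with hk
      have e : branch T a s.length = branch T (Function.update a k c) s.length :=
        branch_eq_of_agree fun i hi => (Function.update_of_ne (by omega) _ _).symm
      refine ⟨Function.update a k c, ?_⟩
      rw [branch_succ_fst, ← e, ha]
      simp [nextBit, ha, hsp, ← hk]
    · refine ⟨a, ?_⟩
      rw [branch_succ_fst, ← eq_nextBit_of_not_split a (c := c) (by rwa [ha])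
        (by rwa [ha]) (by rwa [ha]), ha]

/-- Every branch meets splitting nodes at arbitrarily high levels. -/
lemma PerfectTree.exists_split_branch {T : Set (List Bool)} (hT : PerfectTree T) (a : ℕ → Bool)
    (m : ℕ) : ∃ n ≥ m, SplitNode T (branch T a n).1 := by
  by_contra! hcon
  obtain ⟨u, ⟨r, rfl⟩, hu⟩ := hT.2.2 _ (hT.branch_mem a m)
  have key : ∀ r, (branch T a m).1 ++ r ∈ T →
      (branch T a (m + r.length)).1 = (branch T a m).1 ++ r := by
    intro r
    induction r using List.reverseRecOn with
    | nil => simp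
    | append_singleton r c ih =>
      rw [← List.append_assoc]
      intro hr
      have e := ih (hT.2.1 _ _ ⟨[c], rfl⟩ hr)
      rw [List.length_append, List.length_singleton, ← add_assoc, branch_succ_fst,
        ← eq_nextBit_of_not_split a (hT.branch_mem a _) (hcon _ (by omega)) (e.symm ▸ hr), e]
  exact hcon (m + r.length) (by omega) (key r hu.1 ▸ hu)

lemma PerfectTree.exists_lt_branch_snd {T : Set (List Bool)} (hT : PerfectTree T) (a : ℕ → Bool)
    (j : ℕ) : ∃ n, j < (branch T a n).2 := by
  have step : ∀ m, ∃ n, (branch T a m).2 < (branch T a n).2 := fun m => by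
    obtain ⟨n, hn, hs⟩ := hT.exists_split_branch a m
    have := monotone_branch_snd T a hn
    exact ⟨n + 1, by rw [branch_succ_snd_of_split hs]; exact Nat.lt_succ_of_le this⟩
  induction j with
  | zero => exact (step 0).imp fun _ => pos_of_gt
  | succ j ih =>
    obtain ⟨m, hm⟩ := ih
    exact (step m).imp fun _ hn => by omega

lemma isOpen_lt_branch_snd (T : Set (List Bool)) (j n : ℕ) :
    IsOpen {a : ℕ → Bool | j < (branch T a n).2} := by
  rw [isOpen_iff_mem_nhds]
  intro a ha
  have hopen : IsOpen ((Set.Iio n).pi fun i => ({a i} : Set Bool)) :=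
    isOpen_set_pi (Set.finite_Iio n) fun _ _ => isOpen_discrete _
  filter_upwards [hopen.mem_nhds fun _ _ => rfl] with b hb
  have e : branch T a n = branch T b n :=
    branch_eq_of_agree fun i hi => (hb i (hi.trans_le (branch_snd_le T a n))).symm
  simpa [← e] using ha

/-- By compactness, all branches have passed more than `j` splitting nodes at a common level. -/
lemma PerfectTree.exists_forall_lt_branch_snd {T : Set (List Bool)} (hT : PerfectTree T) (j : ℕ) :
    ∃ n, ∀ a, j < (branch T a n).2 := by
  obtain ⟨n, hn⟩ := isCompact_univ.elim_directed_cover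
    (fun n => {a : ℕ → Bool | j < (branch T a n).2}) (isOpen_lt_branch_snd T j)
    (fun a _ => Set.mem_iUnion.2 (hT.exists_lt_branch_snd a j))
    (Monotone.directed_le fun _ _ h a ha => lt_of_lt_of_le ha (monotone_branch_snd T a h))
  exact ⟨n, fun a => hn (Set.mem_univ a)⟩

/-- `Ψ` maps `S*` onto the set of all perfect trees (Sacks conditions). -/
theorem Psi_surjective_onto_perfect_trees (T : Set (List Bool)) (hT : PerfectTree T) :
    ∃ t : ℕ → (ℕ → Bool) → Bool, InSStar t ∧ Psi t = T := by
  refine ⟨fun n a => nextBit T a (branch T a n), ⟨fun n a b h => ?_, fun j => ?_⟩, ?_⟩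
  · have hle := branch_snd_le T a n
    have e : branch T a n = branch T b n :=
      branch_eq_of_agree fun i hi => h i (hi.le.trans hle)
    beta_reduce
    rw [← e]
    simp only [nextBit, h _ hle]
  · obtain ⟨n, hn⟩ := hT.exists_forall_lt_branch_snd j
    exact ⟨Finset.range n, fun a b h =>
      (agree_of_nextBit_eq fun k hk => h k (Finset.mem_range.2 hk)).2 j (hn a)⟩
  · ext l
    constructor
    · rintro ⟨n, a, rfl⟩
      rw [← branch_fst_eq_ofFn]
      exact hT.branch_mem a n
    · intro hl
      obtain ⟨a, ha⟩ := hT.exists_branch_eq l hl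
      exact ⟨l.length, a, by rw [← branch_fst_eq_ofFn, ha]⟩
end

section
/- Ψ reflects compatibility: if t̄, s̄ ∈ S* and there is a perfect tree T with T ⊆ Ψ(t̄) and T ⊆ Ψ(s̄), then t̄ and s̄ are compatible in S*, i.e., there is r̄ ∈ S* with r̄ ≤ t̄ and r̄ ≤ s̄. -/
theorem mem_Psi_exists_getD {t : ℕ → (ℕ → Bool) → Bool} {l : List Bool} (h : l ∈ Psi t) :
    ∃ c : ℕ → Bool, ∀ i < l.length, t i c = l.getD i false := by
  obtain ⟨n, c, rfl⟩ := h
  refine ⟨c, fun i hi => ?_⟩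
  rw [List.getD_eq_getElem _ _ hi, List.getElem_ofFn]

theorem List.IsPrefix.getD_eq {l₁ l₂ : List Bool} (h : l₁ <+: l₂) {i : ℕ} (hi : i < l₁.length) :
    l₂.getD i false = l₁.getD i false := by
  obtain ⟨x, rfl⟩ := h
  exact List.getD_append _ _ _ _ hi

theorem Determines.mono {t : ℕ → (ℕ → Bool) → Bool} {K L : Finset ℕ} {j : ℕ}
    (h : Determines t K j) (hKL : K ⊆ L) : Determines t L j :=
  fun a b hab => h a b fun k hk => hab k (hKL hk)

theorem exists_determines_range {t : ℕ → (ℕ → Bool) → Bool} {j : ℕ}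
    (h : ∃ K : Finset ℕ, Determines t K j) : ∃ N, ∀ n ≥ N, Determines t (Finset.range n) j := by
  obtain ⟨K, hK⟩ := h
  obtain ⟨N, hN⟩ := K.exists_nat_subset_range
  exact ⟨N, fun n hn => hK.mono (hN.trans (Finset.range_mono hn))⟩

theorem PerfectTree.exists_splitNode_length_ge {T : Set (List Bool)} (hT : PerfectTree T)
    {x : List Bool} (hx : x ∈ T) (n : ℕ) : ∃ y, x <+: y ∧ SplitNode T y ∧ n ≤ y.length := by
  induction n with
  | zero =>
    obtain ⟨y, hxy, hy⟩ := hT.2.2 x hx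
    exact ⟨y, hxy, hy, Nat.zero_le _⟩
  | succ n ih =>
    obtain ⟨y, hxy, hy, hn⟩ := ih
    obtain ⟨z, hyz, hz⟩ := hT.2.2 _ hy.2.1
    have hlen := hyz.length_le
    rw [List.length_concat] at hlen
    refine ⟨z, (hxy.trans ?_).trans hyz, hz, by omega⟩
    rw [List.concat_eq_append]
    exact List.prefix_append _ _

/-- The first `n` values of an assignment, the last one first. -/
def revInit (a : ℕ → Bool) : ℕ → List Bool
  | 0 => []
  | n + 1 => a n :: revInit a n

theorem length_revInit (a : ℕ → Bool) (n : ℕ) : (revInit a n).length = n := by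
  induction n with
  | zero => rfl
  | succ n ih => simp [revInit, ih]

theorem revInit_congr {a b : ℕ → Bool} {n : ℕ} (h : ∀ j < n, a j = b j) :
    revInit a n = revInit b n := by
  induction n with
  | zero => rfl
  | succ n ih => rw [revInit, revInit, h n n.lt_succ_self, ih fun j hj => h j (by omega)]

/-- A fusion scheme in `T` whose nodes at stage `j + 1` have length at least `M j`:
`σ u` is a splitting node, and `σ (b :: u)` extends `σ u` followed by `b`. -/
theorem PerfectTree.exists_scheme {T : Set (List Bool)} (hT : PerfectTree T) (M : ℕ → ℕ) :
    ∃ σ : List Bool → List Bool, (∀ u, σ u ∈ T) ∧ (∀ b u, (σ u).concat b <+: σ (b :: u)) ∧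
      ∀ b u, M u.length ≤ (σ (b :: u)).length := by
  have hnil : [] ∈ T := by
    obtain ⟨x, hx⟩ := hT.1
    exact hT.2.1 _ _ List.nil_prefix hx
  choose! g hg using fun x (hx : x ∈ T) n => hT.exists_splitNode_length_ge hx n
  let σ : List Bool → List Bool :=
    List.rec (g [] 0) fun b u y => g (y.concat b) (M u.length)
  have hsplit : ∀ u, SplitNode T (σ u) := by
    intro u
    induction u with
    | nil => exact (hg [] hnil 0).2.1
    | cons b u ih =>
      cases b
      · exact (hg _ ih.2.1 _).2.1
      · exact (hg _ ih.2.2 _).2.1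
  have hmem : ∀ b u, (σ u).concat b ∈ T := by
    rintro (_ | _) u
    exacts [(hsplit u).2.1, (hsplit u).2.2]
  exact ⟨σ, fun u => (hsplit u).1, fun b u => (hg _ (hmem b u) _).1,
    fun b u => (hg _ (hmem b u) _).2.2⟩

/-- The sequence of terms whose value at `a` is the branch through the nodes `σ (revInit a n)`. -/
def schemeSeq (σ : List Bool → List Bool) : ℕ → (ℕ → Bool) → Bool :=
  fun i a => (σ (revInit a (i + 1))).getD i false

section Scheme

variable {σ : List Bool → List Bool}

theorem scheme_prefix (hσ : ∀ b u, (σ u).concat b <+: σ (b :: u)) (a : ℕ → Bool) {m n : ℕ}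
    (hmn : m ≤ n) : σ (revInit a m) <+: σ (revInit a n) := by
  induction n, hmn using Nat.le_induction with
  | base => exact List.prefix_rfl
  | succ n _ ih =>
    refine (ih.trans ?_).trans (hσ (a n) (revInit a n))
    rw [List.concat_eq_append]
    exact List.prefix_append _ _

theorem scheme_getD_eq (hσ : ∀ b u, (σ u).concat b <+: σ (b :: u)) (a : ℕ → Bool) {m n i : ℕ}
    (hm : i < (σ (revInit a m)).length) (hn : i < (σ (revInit a n)).length) :
    (σ (revInit a m)).getD i false = (σ (revInit a n)).getD i false := by
  rcases le_total m n with h | h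
  · exact ((scheme_prefix hσ a h).getD_eq hm).symm
  · exact (scheme_prefix hσ a h).getD_eq hn

theorem dependsOnly_of_revInit {α : List Bool → Bool} (i : ℕ) :
    DependsOnly (fun a => α (revInit a (i + 1))) {j | j ≤ i} := by
  intro a b hab
  simp only [revInit_congr fun j (hj : j < i + 1) => hab j (Nat.le_of_lt_succ hj)]

theorem inSStar_schemeSeq (hσ : ∀ b u, (σ u).concat b <+: σ (b :: u))
    (hlen : ∀ a i, i < (σ (revInit a (i + 1))).length) : InSStar (schemeSeq σ) := by
  refine ⟨fun i => dependsOnly_of_revInit (α := fun u => (σ u).getD i false) i, fun j => ?_⟩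
  have hsplit : ∀ a m, schemeSeq σ (σ (revInit a m)).length a = a m := by
    intro a m
    have hlt : (σ (revInit a m)).length < ((σ (revInit a m)).concat (a m)).length := by simp
    have hpre : (σ (revInit a m)).concat (a m) <+: σ (revInit a (m + 1)) := hσ _ _
    rw [schemeSeq, scheme_getD_eq hσ a (hlen a _) (hlt.trans_le hpre.length_le), hpre.getD_eq hlt,
      List.concat_eq_append, List.getD_append_right _ _ _ _ le_rfl]
    simp
  obtain ⟨N, hN⟩ := ((List.finite_length_le Bool j).image fun u => (σ u).length).bddAbove
  refine ⟨Finset.range (N + 1), fun a b hab => ?_⟩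
  have key : ∀ m ≤ j, a m = b m := by
    intro m
    induction m using Nat.strong_induction_on with
    | _ m ih =>
      intro hm
      have hr : revInit a m = revInit b m := revInit_congr fun k hk => ih k hk (by omega)
      have hle : (σ (revInit a m)).length ≤ N :=
        hN ⟨revInit a m, by simpa [length_revInit] using hm, rfl⟩
      rw [← hsplit a m, ← hsplit b m, ← hr]
      exact hab _ (Finset.mem_range.2 (Nat.lt_succ_of_le hle))
  exact key j le_rfl

theorem schemeSeq_sle {t : ℕ → (ℕ → Bool) → Bool} (ht : ∀ i, DependsOnly (t i) {j | j ≤ i})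
    (hσt : ∀ u, σ u ∈ Psi t) (hσ : ∀ b u, (σ u).concat b <+: σ (b :: u))
    (hlen : ∀ a i, i < (σ (revInit a (i + 1))).length)
    (hdet : ∀ a j, Determines t (Finset.range (σ (revInit a (j + 1))).length) j) :
    SLE (schemeSeq σ) t := by
  choose c hc using fun u => mem_Psi_exists_getD (hσt u)
  have hφ : ∀ i, schemeSeq σ i = substTerm (t i) fun j a => c (revInit a (j + 1)) j := by
    intro i
    funext a
    rw [schemeSeq, substTerm, ← hc _ i (hlen a i)]
    refine ht i _ _ fun j (hj : j ≤ i) => hdet a j _ _ fun k hk => ?_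
    have hk := Finset.mem_range.1 hk
    have hpre := scheme_prefix hσ a (Nat.succ_le_succ hj)
    rw [hc _ k hk, hc _ k (hk.trans_le hpre.length_le), hpre.getD_eq hk]
  refine ⟨_, hφ, fun i => dependsOnly_of_revInit (α := fun u => c u i) i, fun j => ?_⟩
  obtain ⟨N, hN⟩ := exists_determines_range ((inSStar_schemeSeq hσ hlen).2 j)
  refine ⟨Finset.range N, fun a b hab => hN N le_rfl a b fun k hk => ?_⟩
  rw [hφ]
  refine ht k _ _ fun i (hi : i ≤ k) => hab i ?_
  exact Finset.mem_range.2 (hi.trans_lt (Finset.mem_range.1 hk))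

end Scheme

/-- `Ψ` reflects compatibility: if a perfect tree is contained in both `Ψ(t̄)` and
`Ψ(s̄)` for `t̄, s̄ ∈ S*`, then `t̄` and `s̄` have a common lower bound in `S*`. -/
theorem Psi_reflects_compatibility (t s : ℕ → (ℕ → Bool) → Bool)
    (ht : InSStar t) (hs : InSStar s) (T : Set (List Bool)) (hT : PerfectTree T)
    (hTt : T ⊆ Psi t) (hTs : T ⊆ Psi s) :
    ∃ r : ℕ → (ℕ → Bool) → Bool, InSStar r ∧ SLE r t ∧ SLE r s := by
  choose Mt hMt using fun j => exists_determines_range (ht.2 j)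
  choose Ms hMs using fun j => exists_determines_range (hs.2 j)
  obtain ⟨σ, hσT, hσ, hM⟩ := hT.exists_scheme fun j => max (j + 1) (max (Mt j) (Ms j))
  have hM' : ∀ a j, max (j + 1) (max (Mt j) (Ms j)) ≤ (σ (revInit a (j + 1))).length := by
    intro a j
    simpa only [length_revInit, revInit] using hM (a j) (revInit a j)
  have hlen : ∀ a i, i < (σ (revInit a (i + 1))).length := fun a i =>
    (le_max_left _ _).trans (hM' a i)
  refine ⟨schemeSeq σ, inSStar_schemeSeq hσ hlen,
    schemeSeq_sle ht.1 (fun u => hTt (hσT u)) hσ hlen fun a j => hMt j _ ?_,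
    schemeSeq_sle hs.1 (fun u => hTs (hσT u)) hσ hlen fun a j => hMs j _ ?_⟩
  · exact ((le_max_left _ _).trans (le_max_right _ _)).trans (hM' a j)
  · exact ((le_max_right _ _).trans (le_max_right _ _)).trans (hM' a j)
end
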